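/- arXiv:2407.11817 — 7 statements merged into one kernel-verified Lean document; each statement's English description precedes it below -/
import Mathlib

section
/- Let H be a real Hilbert space and L : H → [0,∞) be Fréchet differentiable such that its gradient ∇L is Lipschitz on bounded sets, i.e., for every R > 0 there exists C_R > 0 with ‖∇L(x) − ∇L(y)‖ ≤ C_R‖x − y‖ whenever ‖x‖, ‖y‖ ≤ R. Then for every initial condition x₀ ∈ H there exists a unique globally defined gradient-flow trajectory x : [0,∞) → H of L starting at x₀. -/
open Set Metric
open scoped NNReal Topology

section LocallyLipschitzODE

variable {E : Type*} [NormedAddCommGroup E] [NormedSpace ℝ E] {f : E → E}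

/-- Two solutions on `[0, T]` of an autonomous ODE whose vector field is Lipschitz on bounded sets
coincide if they start at the same point. -/
theorem eqOn_Icc_of_lipschitzOnWith_closedBall
    (hf : ∀ R : ℝ, ∃ K : ℝ≥0, LipschitzOnWith K f (closedBall 0 R)) {T : ℝ} {α β : ℝ → E}
    (hα : ∀ t ∈ Icc 0 T, HasDerivWithinAt α (f (α t)) (Icc 0 T) t)
    (hβ : ∀ t ∈ Icc 0 T, HasDerivWithinAt β (f (β t)) (Icc 0 T) t)
    (h0 : α 0 = β 0) : EqOn α β (Icc 0 T) := by
  have hαc : ContinuousOn α (Icc 0 T) := HasDerivWithinAt.continuousOn hα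
  have hβc : ContinuousOn β (Icc 0 T) := HasDerivWithinAt.continuousOn hβ
  obtain ⟨A, hA⟩ := isCompact_Icc.exists_bound_of_continuousOn hαc
  obtain ⟨B, hB⟩ := isCompact_Icc.exists_bound_of_continuousOn hβc
  obtain ⟨K, hK⟩ := hf (max A B)
  refine ODE_solution_unique_of_mem_Icc_right (v := fun _ ↦ f) (s := fun _ ↦ closedBall 0 (max A B))
    (fun _ _ ↦ hK) hαc (fun t ht ↦ ?_) (fun t ht ↦ ?_) hβc (fun t ht ↦ ?_) (fun t ht ↦ ?_) h0
  · exact (hα t (Ico_subset_Icc_self ht)).mono_of_mem_nhdsWithin (Icc_mem_nhdsGE_of_mem ht)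
  · simpa using Or.inl (hA t (Ico_subset_Icc_self ht))
  · exact (hβ t (Ico_subset_Icc_self ht)).mono_of_mem_nhdsWithin (Icc_mem_nhdsGE_of_mem ht)
  · simpa using Or.inr (hB t (Ico_subset_Icc_self ht))

/-- A vector field that is Lipschitz on bounded sets has, after multiplication by a suitable cutoff
function equal to `1` on a given ball, a solution on `[0, T]`. -/
theorem exists_cutoff_solution_Icc [CompleteSpace E]
    (hf : ∀ R : ℝ, ∃ K : ℝ≥0, LipschitzOnWith K f (closedBall 0 R)) (x₀ : E) {T : ℝ} (hT : 0 ≤ T)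
    {R : ℝ} (hR : 0 ≤ R) :
    ∃ (χ : E → ℝ) (α : ℝ → E), (∀ z, 0 ≤ χ z ∧ χ z ≤ 1) ∧ (∀ z, ‖z‖ ≤ R → χ z = 1) ∧ α 0 = x₀ ∧
      ∀ t ∈ Icc 0 T, HasDerivWithinAt α (χ (α t) • f (α t)) (Icc 0 T) t := by
  have hbound : ∀ r : ℝ, 0 ≤ r → ∃ M : ℝ≥0, ∀ z, ‖z‖ ≤ r → ‖f z‖ ≤ M := by
    intro r hr
    obtain ⟨K, hK⟩ := hf r
    refine ⟨K * r.toNNReal + ‖f 0‖₊, fun z hz ↦ ?_⟩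
    have h1 := hK.norm_sub_le (x := z) (y := 0) (by simpa using hz) (by simpa using hr)
    have h2 : (K : ℝ) * ‖z‖ ≤ K * r := by gcongr
    have h3 := norm_sub_norm_le (f z) (f 0)
    push_cast
    rw [Real.coe_toNNReal r hr]
    rw [sub_zero] at h1
    linarith
  set χ : E → ℝ := fun z ↦ max 0 (min 1 (R + 1 - ‖z‖)) with hχ
  have hχ0 : ∀ z, 0 ≤ χ z := fun z ↦ le_max_left _ _
  have hχ1 : ∀ z, χ z ≤ 1 := fun z ↦ max_le zero_le_one (min_le_left _ _)
  have hχlip : ∀ z y, |χ z - χ y| ≤ ‖z - y‖ := by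
    intro z y
    have h1 := abs_le.mp (abs_norm_sub_norm_le z y)
    simp only [hχ]
    grind
  obtain ⟨M, hM⟩ := hbound (R + 1) (by linarith)
  have hvM : ∀ z, ‖χ z • f z‖ ≤ M := by
    intro z
    rcases le_total ‖z‖ (R + 1) with hz | hz
    · rw [norm_smul, Real.norm_of_nonneg (hχ0 z)]
      exact (mul_le_of_le_one_left (norm_nonneg _) (hχ1 z)).trans (hM z hz)
    · have : χ z = 0 := max_eq_left ((min_le_right _ _).trans (by linarith))
      simp [this]
  set a : ℝ≥0 := M * T.toNNReal with ha
  obtain ⟨K, hK⟩ := hf (‖x₀‖ + a)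
  obtain ⟨N, hN⟩ := hbound (‖x₀‖ + a) (by positivity)
  have hball : ∀ z ∈ closedBall x₀ a, ‖z‖ ≤ ‖x₀‖ + a := by
    intro z hz
    have := norm_le_norm_add_norm_sub' z x₀
    rw [mem_closedBall, dist_eq_norm] at hz
    linarith
  have hlip : LipschitzOnWith (K + N) (fun z ↦ χ z • f z) (closedBall x₀ a) := by
    refine LipschitzOnWith.of_dist_le_mul fun z hz y hy ↦ ?_
    rw [dist_eq_norm, dist_eq_norm]
    have h1 : χ z • f z - χ y • f y = χ z • (f z - f y) + (χ z - χ y) • f y := by module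
    have h2 := hK.norm_sub_le (x := z) (y := y) (by simpa using hball z hz)
      (by simpa using hball y hy)
    calc ‖χ z • f z - χ y • f y‖ ≤ ‖χ z • (f z - f y)‖ + ‖(χ z - χ y) • f y‖ := by
          rw [h1]; exact norm_add_le _ _
      _ = χ z * ‖f z - f y‖ + |χ z - χ y| * ‖f y‖ := by
          rw [norm_smul, norm_smul, Real.norm_of_nonneg (hχ0 z), Real.norm_eq_abs]
      _ ≤ 1 * (K * ‖z - y‖) + ‖z - y‖ * N := by
          gcongr
          exacts [hχ1 z, hχlip z y, hN y (hball y hy)]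
      _ = ↑(K + N) * ‖z - y‖ := by push_cast; ring
  have hPL : IsPicardLindelof (fun _ z ↦ χ z • f z) (⟨0, le_rfl, hT⟩ : Icc 0 T) x₀ a 0 M (K + N) :=
    .of_time_independent (fun z _ ↦ hvM z) hlip (by simp [ha, hT])
  obtain ⟨α, hα0, hα⟩ := hPL.exists_eq_forall_mem_Icc_hasDerivWithinAt₀
  refine ⟨χ, α, fun z ↦ ⟨hχ0 z, hχ1 z⟩, fun z hz ↦ ?_, hα0, hα⟩
  rw [hχ]
  dsimp only
  rw [min_eq_left (by linarith), max_eq_right zero_le_one]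

/-- If a vector field that is Lipschitz on bounded sets has solutions on all intervals `[0, T]`,
then it has a solution on `[0, ∞)`. -/
theorem exists_solution_Ici_of_forall_Icc
    (hf : ∀ R : ℝ, ∃ K : ℝ≥0, LipschitzOnWith K f (closedBall 0 R)) {x₀ : E}
    (h : ∀ T : ℝ, 0 ≤ T → ∃ α : ℝ → E, α 0 = x₀ ∧
      ∀ t ∈ Icc 0 T, HasDerivWithinAt α (f (α t)) (Icc 0 T) t) :
    ∃ x : ℝ → E, x 0 = x₀ ∧ ∀ t ∈ Ici (0 : ℝ), HasDerivWithinAt x (f (x t)) (Ici 0) t := by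
  choose! α hα0 hα using h
  have heq : ∀ s T : ℝ, 0 ≤ s → s ≤ T → α (s + 1) s = α T s := by
    intro s T hs hsT
    exact eqOn_Icc_of_lipschitzOnWith_closedBall (T := s) hf
      (fun t ht ↦ (hα (s + 1) (by linarith) t ⟨ht.1, by linarith [ht.2]⟩).mono
        (Icc_subset_Icc_right (by linarith)))
      (fun t ht ↦ (hα T (by linarith) t ⟨ht.1, ht.2.trans hsT⟩).mono (Icc_subset_Icc_right hsT))
      (by rw [hα0 _ (by linarith), hα0 _ (by linarith)]) ⟨hs, le_rfl⟩
  refine ⟨fun s ↦ α (s + 1) s, hα0 _ (by norm_num), fun t ht ↦ ?_⟩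
  have ht0 : 0 ≤ t := ht
  have hmem : Icc 0 (t + 1) ∈ 𝓝[Ici 0] t := by
    rw [← Ici_inter_Iic]
    exact inter_mem_nhdsWithin _ (Iic_mem_nhds (by linarith))
  refine ((hα (t + 1) (by linarith) t ⟨ht0, by linarith⟩).mono_of_mem_nhdsWithin
    hmem).congr_of_eventuallyEq ?_ rfl
  filter_upwards [hmem] with s hs using heq s (t + 1) hs.1 hs.2

end LocallyLipschitzODE

section GradientFlow

variable {H : Type*} [NormedAddCommGroup H] [InnerProductSpace ℝ H] [CompleteSpace H] {L : H → ℝ}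

/-- A priori bound for a slowed-down gradient flow of a nonnegative function. -/
theorem norm_sub_le_of_slowed_gradient_flow (hL_nonneg : ∀ z, 0 ≤ L z)
    (hL_diff : Differentiable ℝ L) {χ : H → ℝ} (hχ : ∀ z, 0 ≤ χ z ∧ χ z ≤ 1) {T : ℝ} {α : ℝ → H}
    (hα : ∀ t ∈ Icc 0 T, HasDerivWithinAt α (χ (α t) • -gradient L (α t)) (Icc 0 T) t) :
    ∀ t ∈ Icc 0 T, ‖α t - α 0‖ ≤ (T + L (α 0)) / 2 := by
  have hαc : ContinuousOn α (Icc 0 T) := HasDerivWithinAt.continuousOn hα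
  have hα' : ∀ t ∈ Ico 0 T, HasDerivWithinAt α (χ (α t) • -gradient L (α t)) (Ici t) t :=
    fun t ht ↦ (hα t (Ico_subset_Icc_self ht)).mono_of_mem_nhdsWithin (Icc_mem_nhdsGE_of_mem ht)
  have hLα : ∀ t ∈ Ico 0 T,
      HasDerivWithinAt (fun s ↦ L (α s)) (-(χ (α t) * ‖gradient L (α t)‖ ^ 2)) (Ici t) t := by
    intro t ht
    have := (hL_diff (α t)).hasGradientAt.hasFDerivAt.comp_hasDerivWithinAt t (hα' t ht)
    convert! this using 1
    rw [InnerProductSpace.toDual_apply_apply, inner_smul_right, inner_neg_right,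
      real_inner_self_eq_norm_sq, mul_neg]
  intro t ht
  have key := image_norm_le_of_norm_deriv_right_le_deriv_boundary'
    (f := fun s ↦ α s - α 0) (B := fun s ↦ (s + (L (α 0) - L (α s))) / 2)
    (hαc.sub continuousOn_const) (fun s hs ↦ (hα' s hs).sub_const _) (by simp)
    ((continuousOn_id.add (continuousOn_const.sub
      (hL_diff.continuous.comp_continuousOn hαc))).div_const 2)
    (fun s hs ↦ ((hasDerivWithinAt_id s _).add ((hLα s hs).const_sub _)).div_const 2)
    (fun s hs ↦ by
      obtain ⟨h0, h1⟩ := hχ (α s)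
      rw [norm_smul, norm_neg, Real.norm_of_nonneg h0]
      nlinarith [mul_nonneg h0 (sq_nonneg (‖gradient L (α s)‖ - 1))]) ht
  have := hL_nonneg (α t)
  refine key.trans ?_
  linarith [ht.2]

end GradientFlow

/-- Let `H` be a real Hilbert space and `L : H → [0,∞)` Fréchet
differentiable, with gradient Lipschitz on bounded sets. Then for every initial condition
`x₀` there is a unique globally defined gradient-flow trajectory of `L` on `[0,∞)`
starting at `x₀`. -/
theorem stmt_0 {H : Type*} [NormedAddCommGroup H] [InnerProductSpace ℝ H] [CompleteSpace H]
    (L : H → ℝ) (hL_nonneg : ∀ z, 0 ≤ L z)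
    (hL_diff : Differentiable ℝ L)
    (hL_lip : ∀ R > (0 : ℝ), ∃ C > (0 : ℝ), ∀ z y : H, ‖z‖ ≤ R → ‖y‖ ≤ R →
      ‖gradient L z - gradient L y‖ ≤ C * ‖z - y‖)
    (x₀ : H) :
    ∃ x : ℝ → H,
      (x 0 = x₀ ∧
        ∀ t ∈ Set.Ici (0 : ℝ), HasDerivWithinAt x (-gradient L (x t)) (Set.Ici 0) t) ∧
      ∀ y : ℝ → H,
        (y 0 = x₀ ∧
          ∀ t ∈ Set.Ici (0 : ℝ), HasDerivWithinAt y (-gradient L (y t)) (Set.Ici 0) t) →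
        ∀ t ∈ Set.Ici (0 : ℝ), y t = x t := by
  have hf : ∀ R : ℝ, ∃ K : ℝ≥0, LipschitzOnWith K (fun z ↦ -gradient L z) (closedBall 0 R) := by
    intro R
    obtain ⟨C, hC, h⟩ := hL_lip (max R 1) (by positivity)
    refine ⟨C.toNNReal, LipschitzOnWith.of_dist_le_mul fun z hz y hy ↦ ?_⟩
    rw [dist_neg_neg, dist_eq_norm, dist_eq_norm, Real.coe_toNNReal C hC.le]
    exact h z y (le_max_of_le_left (by simpa using hz)) (le_max_of_le_left (by simpa using hy))
  obtain ⟨x, hx0, hx⟩ := exists_solution_Ici_of_forall_Icc hf (x₀ := x₀) fun T hT ↦ by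
    have := hL_nonneg x₀
    obtain ⟨χ, α, hχ, hχ1, hα0, hα⟩ :=
      exists_cutoff_solution_Icc hf x₀ hT (R := ‖x₀‖ + (T + L x₀) / 2) (by positivity)
    refine ⟨α, hα0, fun t ht ↦ ?_⟩
    have h1 := norm_sub_le_of_slowed_gradient_flow hL_nonneg hL_diff hχ hα t ht
    rw [hα0] at h1
    have h2 : χ (α t) = 1 := hχ1 _ (by linarith [norm_sub_norm_le (α t) x₀])
    simpa [h2] using hα t ht
  refine ⟨x, ⟨hx0, hx⟩, fun y ⟨hy0, hy⟩ t ht ↦ ?_⟩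
  exact eqOn_Icc_of_lipschitzOnWith_closedBall (T := t) hf
    (fun s hs ↦ (hy s hs.1).mono Icc_subset_Ici_self)
    (fun s hs ↦ (hx s hs.1).mono Icc_subset_Ici_self) (hy0.trans hx0.symm) ⟨ht, le_rfl⟩
end

section
/- Let H be a real Hilbert space and L : H → [0,∞) be twice continuously Fréchet differentiable. Let c : [0,∞) → [0,∞) be nonincreasing and such that for every r ≥ 0 and every x ∈ H with ‖x‖ ≤ r one has ‖∇L(x)‖ ≥ c(r)·√(L(x)), and set C(z) := ∫₀^z c(v) dv. Then for every gradient-flow trajectory x : [0,∞) → H of L and every t ≥ 0, C(‖x(0)‖ + ∫₀^t ‖x'(s)‖ ds) + 2√(L(x(t))) ≤ C(‖x(0)‖) + 2√(L(x(0))). -/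
open Set Filter Topology

/-- A nonnegative function has zero gradient at each of its zeros. -/
lemma gradient_eq_zero_of_nonneg_of_eq_zero {H : Type*} [NormedAddCommGroup H]
    [InnerProductSpace ℝ H] [CompleteSpace H] {L : H → ℝ} (hL : ∀ z, 0 ≤ L z) {z : H}
    (hz : L z = 0) : gradient L z = 0 := by
  have hmin : IsLocalMin L z := Eventually.of_forall fun w => hz.trans_le (hL w)
  simp [gradient, hmin.fderiv_eq_zero]

/-- The primitive of an antitone function grows at most linearly to the right of each point,
with the value of the function at that point as its slope. -/
lemma Antitone.integral_le_mul_sub {c : ℝ → ℝ} (hc : Antitone c) {a b : ℝ} (hab : a ≤ b) :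
    ∫ v in a..b, c v ≤ c a * (b - a) := by
  have h := intervalIntegral.integral_mono_on (μ := MeasureTheory.volume) hab
    hc.intervalIntegrable (intervalIntegrable_const (c := c a)) fun v hv => hc hv.1
  rwa [intervalIntegral.integral_const, smul_eq_mul, mul_comm] at h

/-- If `φ` and `E` are such that `E ≥ 0` decreases at rate `φ' ^ 2`, if `φ'` dominates
`c (φ) * √E`, and if `E` can only vanish together with `φ'`, then
`∫₀^φ c + 2 * √E` does not increase. -/
lemma integral_add_two_mul_sqrt_le {c φ g E : ℝ → ℝ} (hc : Antitone c)
    (hφ : ∀ s, 0 ≤ s → HasDerivWithinAt φ (g s) (Ici 0) s) (hg : ∀ s, 0 ≤ s → 0 ≤ g s)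
    (hE : ∀ s, 0 ≤ s → HasDerivWithinAt E (-(g s ^ 2)) (Ici 0) s) (hE0 : ∀ s, 0 ≤ E s)
    (hzero : ∀ s, 0 ≤ s → E s = 0 → g s = 0)
    (hdom : ∀ s, 0 ≤ s → c (φ s) * √(E s) ≤ g s) {t : ℝ} (ht : 0 ≤ t) :
    (∫ v in (0 : ℝ)..φ t, c v) + 2 * √(E t) ≤ (∫ v in (0 : ℝ)..φ 0, c v) + 2 * √(E 0) := by
  have hφc : ContinuousOn φ (Ici 0) := fun s hs => (hφ s hs).continuousWithinAt
  have hEc : ContinuousOn E (Ici 0) := fun s hs => (hE s hs).continuousWithinAt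
  have hφmono : MonotoneOn φ (Ici 0) :=
    monotoneOn_of_hasDerivWithinAt_nonneg (convex_Ici 0) hφc
      (fun s hs => (hφ s (interior_subset hs)).mono interior_subset)
      fun s hs => hg s (interior_subset hs)
  have hEanti : AntitoneOn E (Ici 0) :=
    antitoneOn_of_hasDerivWithinAt_nonpos (convex_Ici 0) hEc
      (fun s hs => (hE s (interior_subset hs)).mono interior_subset)
      fun s _ => neg_nonpos.2 (sq_nonneg _)
  have hCc : Continuous fun z => ∫ v in (0 : ℝ)..z, c v :=
    intervalIntegral.continuous_primitive (fun _ _ => hc.intervalIntegrable) 0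
  refine image_le_of_liminf_slope_right_le_deriv_boundary (a := 0) (b := t)
    (f := fun s => (∫ v in (0 : ℝ)..φ s, c v) + 2 * √(E s))
    (B := fun _ => (∫ v in (0 : ℝ)..φ 0, c v) + 2 * √(E 0)) (B' := fun _ => 0)
    ?_ le_rfl continuousOn_const (fun _ _ => hasDerivWithinAt_const _ _ _) ?_
    (right_mem_Icc.2 ht)
  · exact ((hCc.comp_continuousOn hφc).add
      (continuousOn_const.mul hEc.sqrt)).mono Icc_subset_Ici_self
  rintro s ⟨hs, -⟩ r hr
  have hsub : Ioi s ⊆ Ici 0 := fun z hz => hs.trans (le_of_lt hz)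
  refine Eventually.frequently ?_
  rcases (hE0 s).eq_or_lt' with h0 | hpos
  · have hEz : ∀ z, s ≤ z → E z = 0 := fun z hz =>
      le_antisymm ((hEanti hs (hs.trans hz) hz).trans h0.le) (hE0 z)
    filter_upwards [self_mem_nhdsWithin] with z hz
    have hz : s < z := hz
    have hφz : φ z = φ s :=
      constant_of_has_deriv_right_zero (a := s) (b := z)
        (hφc.mono fun w hw => hs.trans hw.1)
        (fun w hw => by
          have h := hφ w (hs.trans hw.1)
          rw [hzero w (hs.trans hw.1) (hEz w hw.1)] at h
          exact h.mono fun v hv => (hs.trans hw.1).trans hv)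
        z (right_mem_Icc.2 hz.le)
    simpa [slope, hφz, h0, hEz z hz.le] using hr
  · have hsq : 0 < √(E s) := Real.sqrt_pos.2 hpos
    have hlim : Tendsto (fun z => c (φ s) * slope φ s z + 2 * slope (fun w => √(E w)) s z)
        (𝓝[>] s) (𝓝 (c (φ s) * g s + 2 * (-(g s ^ 2) / (2 * √(E s))))) := by
      have h1 := (hasDerivWithinAt_iff_tendsto_slope' self_notMem_Ioi).1 ((hφ s hs).mono hsub)
      have h2 := (hasDerivWithinAt_iff_tendsto_slope' self_notMem_Ioi).1
        (((hE s hs).sqrt hpos.ne').mono hsub)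
      exact (h1.const_mul _).add (h2.const_mul _)
    have hle : c (φ s) * g s + 2 * (-(g s ^ 2) / (2 * √(E s))) ≤ 0 := by
      have h : c (φ s) * g s + 2 * (-(g s ^ 2) / (2 * √(E s)))
          = g s * (c (φ s) * √(E s) - g s) / √(E s) := by
        field_simp
        ring
      rw [h]
      exact div_nonpos_of_nonpos_of_nonneg
        (mul_nonpos_of_nonneg_of_nonpos (hg s hs) (sub_nonpos.2 (hdom s hs))) hsq.le
    filter_upwards [hlim.eventually_lt_const (hle.trans_lt hr), self_mem_nhdsWithin]
      with z hz hsz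
    have hsz : s < z := hsz
    refine lt_of_le_of_lt ?_ hz
    have hint := hc.integral_le_mul_sub (hφmono hs (hs.trans hsz.le) hsz.le)
    rw [← intervalIntegral.integral_interval_sub_left (a := 0)
      hc.intervalIntegrable hc.intervalIntegrable] at hint
    have hzs : 0 < z - s := sub_pos.2 hsz
    simp only [slope_def_field]
    rw [← mul_div_assoc, ← mul_div_assoc, ← add_div]
    gcongr
    linarith

/-- (Łojasiewicz-type energy bound along a gradient flow.)
For a twice continuously differentiable `L : H → [0,∞)`, a nonincreasing
`c : [0,∞) → [0,∞)` with `‖∇L(x)‖ ≥ c(r)·√(L(x))` whenever `‖x‖ ≤ r`, and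
`C(z) = ∫₀^z c(v) dv`, every gradient-flow trajectory `x` of `L` satisfies, for `t ≥ 0`,
`C(‖x(0)‖ + ∫₀^t ‖x'(s)‖ ds) + 2√(L(x(t))) ≤ C(‖x(0)‖) + 2√(L(x(0)))`.
(Along the flow `‖x'(s)‖ = ‖∇L(x(s))‖`.) -/
theorem stmt_2 {H : Type*} [NormedAddCommGroup H] [InnerProductSpace ℝ H] [CompleteSpace H]
    (L : H → ℝ) (hL_nonneg : ∀ z, 0 ≤ L z) (hL : ContDiff ℝ 2 L)
    (c : ℝ → ℝ) (hc_nonneg : ∀ r, 0 ≤ r → 0 ≤ c r) (hc_anti : AntitoneOn c (Set.Ici 0))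
    (hLoj : ∀ r, 0 ≤ r → ∀ z : H, ‖z‖ ≤ r → c r * Real.sqrt (L z) ≤ ‖gradient L z‖)
    (x : ℝ → H)
    (hx : ∀ t ∈ Set.Ici (0 : ℝ), HasDerivWithinAt x (-gradient L (x t)) (Set.Ici 0) t)
    (t : ℝ) (ht : 0 ≤ t) :
    (∫ v in (0 : ℝ)..(‖x 0‖ + ∫ s in (0 : ℝ)..t, ‖gradient L (x s)‖), c v)
        + 2 * Real.sqrt (L (x t)) ≤
      (∫ v in (0 : ℝ)..‖x 0‖, c v) + 2 * Real.sqrt (L (x 0)) := by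
  have hmax : ∀ {v : ℝ}, 0 ≤ v → max v 0 = v := fun h => max_eq_left h
  have hgrad : Continuous (gradient L) :=
    (InnerProductSpace.toDual ℝ H).symm.continuous.comp (hL.continuous_fderiv (by norm_num))
  have hxc : ContinuousOn x (Ici 0) := fun s hs => (hx s hs).continuousWithinAt
  have hgc : Continuous fun s => ‖gradient L (x (max s 0))‖ :=
    (hgrad.comp (hxc.comp_continuous (by fun_prop) fun s => le_max_right s 0)).norm
  have hc' : Antitone fun v => c (max v 0) := fun a b hab =>
    hc_anti (le_max_right a 0) (le_max_right b 0) (max_le_max_right 0 hab)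
  set φ : ℝ → ℝ := fun s => ‖x 0‖ + ∫ w in (0 : ℝ)..s, ‖gradient L (x (max w 0))‖ with hφdef
  have hφ : ∀ s, HasDerivAt φ ‖gradient L (x (max s 0))‖ s := fun s =>
    (hgc.integral_hasStrictDerivAt 0 s).hasDerivAt.const_add _
  have hφ0 : φ 0 = ‖x 0‖ := by simp [hφdef]
  have hφt : ‖x 0‖ + ∫ s in (0 : ℝ)..t, ‖gradient L (x s)‖ = φ t := by
    simp only [hφdef]
    congr 1
    refine intervalIntegral.integral_congr fun s hs => ?_
    rw [uIcc_of_le ht] at hs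
    simp only [hmax hs.1]
  have hnorm : ∀ s, 0 ≤ s → ‖x s‖ ≤ φ s := fun s hs =>
    image_norm_le_of_norm_deriv_right_le_deriv_boundary (a := 0) (b := s)
      (hxc.mono Icc_subset_Ici_self)
      (fun w hw => (hx w hw.1).mono (Ici_subset_Ici.2 hw.1)) hφ0.ge
      hφ
      (fun w hw => by rw [hmax hw.1, norm_neg]) (right_mem_Icc.2 hs)
  have hφnn : ∀ s, 0 ≤ s → 0 ≤ φ s := fun s hs => (norm_nonneg _).trans (hnorm s hs)
  have hC : ∀ z, 0 ≤ z → ∫ v in (0 : ℝ)..z, c v = ∫ v in (0 : ℝ)..z, c (max v 0) := by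
    intro z hz
    refine intervalIntegral.integral_congr fun v hv => ?_
    rw [uIcc_of_le hz] at hv
    simp only [hmax hv.1]
  rw [hφt, hC _ (hφnn t ht), hC _ (norm_nonneg _), ← hφ0]
  refine integral_add_two_mul_sqrt_le (g := fun s => ‖gradient L (x (max s 0))‖)
    (E := fun s => L (x s)) hc' (fun s _ => (hφ s).hasDerivWithinAt)
    (fun s _ => norm_nonneg _) (fun s hs => ?_) (fun s => hL_nonneg _) (fun s hs h => ?_)
    (fun s hs => ?_) ht
  · have hgradL := ((hL.differentiable (by norm_num)) (x s)).hasGradientAt.hasFDerivAt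
    have h := hgradL.comp_hasDerivWithinAt s (hx s hs)
    rw [InnerProductSpace.toDual_apply_apply, inner_neg_right, real_inner_self_eq_norm_sq] at h
    simp only [hmax hs]
    exact h
  · simp [hmax hs, gradient_eq_zero_of_nonneg_of_eq_zero hL_nonneg h]
  · simpa [hmax hs, hmax (hφnn s hs)] using hLoj (φ s) (hφnn s hs) (x s) (hnorm s hs)
end

section
/- Let H be a real Hilbert space and L : H → [0,∞) be twice continuously Fréchet differentiable. Assume that for every r > 0 there exists c_r > 0 such that ‖∇L(x)‖ ≥ c_r·√(L(x)) for all x ∈ H with ‖x‖ ≤ r. Let x : [0,∞) → H be a gradient-flow trajectory of L that is bounded, i.e., sup_{t ≥ 0} ‖x(t)‖ < ∞. Then there exists x_∞ ∈ H with L(x_∞) = 0 such that x(t) → x_∞ in H as t → ∞. -/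
section GradientFlow

open Set Filter Topology

variable {H : Type*} [NormedAddCommGroup H] [InnerProductSpace ℝ H] [CompleteSpace H]
  {L : H → ℝ} {x : ℝ → H} {c : ℝ}

/-- Energy identity: along a gradient flow, `L` decreases at the rate `‖∇L‖²`. -/
theorem hasDerivWithinAt_comp_gradientFlow {s : Set ℝ} {t : ℝ}
    (hL : DifferentiableAt ℝ L (x t)) (hx : HasDerivWithinAt x (-gradient L (x t)) s t) :
    HasDerivWithinAt (fun t => L (x t)) (-‖gradient L (x t)‖ ^ 2) s t := by
  have h := hL.hasGradientAt.hasFDerivAt.comp_hasDerivWithinAt t hx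
  rw [map_neg, InnerProductSpace.toDual_apply_apply, real_inner_self_eq_norm_sq] at h
  exact h

/-- Under a Polyak–Łojasiewicz inequality along the trajectory, `L` decays exponentially. -/
theorem antitoneOn_exp_mul_comp_gradientFlow (hL : Differentiable ℝ L) (hL0 : ∀ z, 0 ≤ L z)
    (hx : ∀ t ∈ Ici (0 : ℝ), HasDerivWithinAt x (-gradient L (x t)) (Ici 0) t) (hc : 0 ≤ c)
    (hPL : ∀ t ∈ Ici (0 : ℝ), c * √(L (x t)) ≤ ‖gradient L (x t)‖) :
    AntitoneOn (fun t => Real.exp (c ^ 2 * t) * L (x t)) (Ici 0) := by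
  have hd : ∀ t ∈ Ici (0 : ℝ), HasDerivWithinAt (fun t => Real.exp (c ^ 2 * t) * L (x t))
      (Real.exp (c ^ 2 * t) * c ^ 2 * L (x t) +
        Real.exp (c ^ 2 * t) * -‖gradient L (x t)‖ ^ 2) (Ici 0) t := fun t ht =>
    HasDerivWithinAt.mul
      (by simpa using ((hasDerivAt_id t).const_mul (c ^ 2)).exp.hasDerivWithinAt)
      (hasDerivWithinAt_comp_gradientFlow (hL _) (hx t ht))
  refine antitoneOn_of_hasDerivWithinAt_nonpos (convex_Ici 0)
    (fun t ht => (hd t ht).continuousWithinAt)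
    (fun t ht => (hd t (interior_subset ht)).mono interior_subset) fun t ht => ?_
  have h := pow_le_pow_left₀ (by positivity) (hPL t (interior_subset ht)) 2
  rw [mul_pow, Real.sq_sqrt (hL0 _)] at h
  nlinarith [Real.exp_pos (c ^ 2 * t)]

/-- Length estimate for a gradient flow that stays away from the zeros of `L`. -/
theorem norm_sub_le_of_gradientFlow (hL : Differentiable ℝ L)
    (hx : ∀ t ∈ Ici (0 : ℝ), HasDerivWithinAt x (-gradient L (x t)) (Ici 0) t) (hc : 0 < c)
    (hPL : ∀ t ∈ Ici (0 : ℝ), c * √(L (x t)) ≤ ‖gradient L (x t)‖)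
    (hpos : ∀ t ∈ Ici (0 : ℝ), 0 < L (x t)) {s t : ℝ} (hs : 0 ≤ s) (hst : s ≤ t) :
    ‖x t - x s‖ ≤ 2 / c * (√(L (x s)) - √(L (x t))) := by
  have hsub : Icc s t ⊆ Ici 0 := fun u hu => hs.trans hu.1
  have hg : ∀ u ∈ Ici (0 : ℝ), HasDerivWithinAt
      (fun u => 2 / c * (√(L (x s)) - √(L (x u))))
      (2 / c * -(-‖gradient L (x u)‖ ^ 2 / (2 * √(L (x u))))) (Ici 0) u := fun u hu =>
    (((hasDerivWithinAt_comp_gradientFlow (hL _) (hx u hu)).sqrt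
      (hpos u hu).ne').const_sub _).const_mul _
  refine image_norm_le_of_norm_deriv_right_le_deriv_boundary' (f := fun u => x u - x s)
    (a := s) (b := t)
    (fun u hu => (((hx u (hsub hu)).continuousWithinAt.mono hsub).sub continuousWithinAt_const))
    (fun u hu => ((hx u (hs.trans hu.1)).mono (Ici_subset_Ici.2 (hs.trans hu.1))).sub_const _)
    (by simp) (fun u hu => (hg u (hsub hu)).continuousWithinAt.mono hsub)
    (fun u hu => (hg u (hs.trans hu.1)).mono (Ici_subset_Ici.2 (hs.trans hu.1)))
    (fun u hu => ?_) (right_mem_Icc.2 hst)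
  have hu0 : u ∈ Ici (0 : ℝ) := hs.trans hu.1
  have hsq : 0 < √(L (x u)) := Real.sqrt_pos.2 (hpos u hu0)
  have h := mul_le_mul_of_nonneg_left (hPL u hu0) (norm_nonneg (gradient L (x u)))
  rw [norm_neg]
  have : 2 / c * -(-‖gradient L (x u)‖ ^ 2 / (2 * √(L (x u)))) =
      ‖gradient L (x u)‖ ^ 2 / (c * √(L (x u))) := by
    field_simp
  rw [this, le_div_iff₀ (by positivity)]
  linarith [sq ‖gradient L (x u)‖]

end GradientFlow


/-- If `L : H → [0,∞)` is C² and satisfies, on every ball, a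
Polyak–Łojasiewicz inequality `‖∇L(x)‖ ≥ c_r √(L(x))` with `c_r > 0`, then every bounded
gradient-flow trajectory of `L` converges to a zero of `L`. -/
theorem stmt_5 {H : Type*} [NormedAddCommGroup H] [InnerProductSpace ℝ H] [CompleteSpace H]
    (L : H → ℝ) (hL_nonneg : ∀ z, 0 ≤ L z) (hL : ContDiff ℝ 2 L)
    (hLoj : ∀ r > (0 : ℝ), ∃ c > (0 : ℝ), ∀ z : H, ‖z‖ ≤ r →
      c * Real.sqrt (L z) ≤ ‖gradient L z‖)
    (x : ℝ → H)
    (hx : ∀ t ∈ Set.Ici (0 : ℝ), HasDerivWithinAt x (-gradient L (x t)) (Set.Ici 0) t)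
    (hbdd : ∃ M : ℝ, ∀ t : ℝ, 0 ≤ t → ‖x t‖ ≤ M) :
    ∃ xinf : H, L xinf = 0 ∧ Filter.Tendsto x Filter.atTop (nhds xinf) := by
  open Set Filter Topology in
  obtain ⟨M, hM⟩ := hbdd
  obtain ⟨c, hc, hcM⟩ := hLoj (max M 1) (by positivity)
  have hPL : ∀ t ∈ Ici (0 : ℝ), c * √(L (x t)) ≤ ‖gradient L (x t)‖ := fun t ht =>
    hcM _ ((hM t ht).trans (le_max_left _ _))
  have hLd : Differentiable ℝ L := hL.differentiable (by norm_num)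
  have hanti := antitoneOn_exp_mul_comp_gradientFlow hLd hL_nonneg hx hc.le hPL
  by_cases hzero : ∃ t₀ ∈ Ici (0 : ℝ), L (x t₀) = 0
  · obtain ⟨t₀, ht₀, h0⟩ := hzero
    have hz : ∀ t, t₀ ≤ t → L (x t) = 0 := fun t ht => by
      have h := hanti ht₀ (le_trans ht₀ ht) ht
      simp only [h0, mul_zero] at h
      exact le_antisymm (nonpos_of_mul_nonpos_right h (Real.exp_pos _)) (hL_nonneg _)
    have hgrad : ∀ t, t₀ ≤ t → gradient L (x t) = 0 := fun t ht => by
      have hmin : IsLocalMin L (x t) := Eventually.of_forall fun z => by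
        rw [hz t ht]; exact hL_nonneg z
      simp [gradient, hmin.fderiv_eq_zero]
    have hsub : Ici t₀ ⊆ Ici (0 : ℝ) := Ici_subset_Ici.2 ht₀
    refine ⟨x t₀, h0, tendsto_const_nhds.congr' ?_⟩
    filter_upwards [eventually_ge_atTop t₀] with t ht
    refine (constant_of_has_deriv_right_zero (a := t₀) (b := t)
      (fun u hu => (hx u (hsub hu.1)).continuousWithinAt.mono fun v hv => hsub hv.1)
      (fun u hu => ?_) t (right_mem_Icc.2 ht)).symm
    have h := (hx u (hsub hu.1)).mono (Ici_subset_Ici.2 (hsub hu.1))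
    rwa [hgrad u hu.1, neg_zero] at h
  · push Not at hzero
    have hpos : ∀ t ∈ Ici (0 : ℝ), 0 < L (x t) := fun t ht =>
      (hL_nonneg _).lt_of_ne' (hzero t ht)
    have hlim : Tendsto (fun t => L (x t)) atTop (𝓝 0) := by
      have hexp : Tendsto (fun t : ℝ => L (x 0) / Real.exp (c ^ 2 * t)) atTop (𝓝 0) :=
        tendsto_const_nhds.div_atTop
          (Real.tendsto_exp_atTop.comp (tendsto_id.const_mul_atTop (by positivity)))
      refine tendsto_of_tendsto_of_tendsto_of_le_of_le' tendsto_const_nhds hexp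
        (Eventually.of_forall fun t => hL_nonneg _) ?_
      filter_upwards [eventually_ge_atTop (0 : ℝ)] with t ht
      rw [le_div_iff₀ (Real.exp_pos _), mul_comm]
      simpa using hanti self_mem_Ici ht ht
    have hmax : Tendsto (fun t : ℝ => max t 0) atTop atTop :=
      tendsto_atTop_mono (fun t => le_max_left t 0) tendsto_id
    have hcauchy : CauchySeq fun t : ℝ => x (max t 0) := by
      refine cauchySeq_of_le_tendsto_0' (fun t => 2 / c * √(L (x (max t 0)))) (fun s t hst => ?_) ?_
      · rw [dist_comm, dist_eq_norm]
        refine (norm_sub_le_of_gradientFlow hLd hx hc hPL hpos (le_max_right _ _)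
          (max_le_max_right 0 hst)).trans ?_
        gcongr
        linarith [Real.sqrt_nonneg (L (x (max t 0)))]
      · simpa using ((hlim.comp hmax).sqrt).const_mul (2 / c)
    obtain ⟨xinf, hxinf⟩ := cauchySeq_tendsto_of_complete hcauchy
    have hxlim : Tendsto x atTop (𝓝 xinf) := hxinf.congr' <| by
      filter_upwards [eventually_ge_atTop (0 : ℝ)] with t ht
      rw [max_eq_left ht]
    exact ⟨xinf, tendsto_nhds_unique ((hLd.continuous.tendsto xinf).comp hxlim) hlim, hxlim⟩
end

section
/- Let H be a real Hilbert space, L : H → [0,∞) be twice continuously Fréchet differentiable, and let x₀ ∈ H, R > 0, c > 0 be such that ‖∇L(x)‖ ≥ c·√(L(x)) for every x ∈ H with ‖x − x₀‖ ≤ R, and such that 2√(L(x₀)) ≤ cR. Then every gradient-flow trajectory x : [0,∞) → H of L starting at x₀ converges: there exists x_∞ ∈ H with ‖x_∞ − x₀‖ ≤ R and L(x_∞) = 0 such that x(t) → x_∞ in H as t → ∞. -/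
open Set Filter Topology

section GradientFlow

variable {H : Type*} [NormedAddCommGroup H] [InnerProductSpace ℝ H] [CompleteSpace H]
  {L : H → ℝ} {x : ℝ → H}

/-- `x` solves the gradient-flow equation of `L` on `[0, ∞)`. -/
def IsGradientFlow (L : H → ℝ) (x : ℝ → H) : Prop :=
  ∀ t ∈ Ici (0 : ℝ), HasDerivWithinAt x (-gradient L (x t)) (Ici 0) t

lemma gradient_eq_zero_of_eq_zero (hL : ∀ z, 0 ≤ L z) {z : H} (hz : L z = 0) :
    gradient L z = 0 := by
  have h : IsLocalMin L z := Eventually.of_forall fun y => hz ▸ hL y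
  rw [gradient, h.fderiv_eq_zero, map_zero]

namespace IsGradientFlow

lemma continuousOn (hx : IsGradientFlow L x) : ContinuousOn x (Ici 0) :=
  fun t ht => (hx t ht).continuousWithinAt

/-- Energy dissipation along the flow. -/
lemma hasDerivWithinAt_energy (hx : IsGradientFlow L x) (hd : Differentiable ℝ L) {t : ℝ}
    (ht : 0 ≤ t) :
    HasDerivWithinAt (fun s => L (x s)) (-‖gradient L (x t)‖ ^ 2) (Ici 0) t := by
  have h := (hd (x t)).hasGradientAt.hasFDerivAt.comp_hasDerivWithinAt t (hx t ht)
  convert! h using 1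
  rw [InnerProductSpace.toDual_apply_apply, inner_neg_right, real_inner_self_eq_norm_sq]

lemma continuousOn_energy (hx : IsGradientFlow L x) (hd : Differentiable ℝ L) :
    ContinuousOn (fun s => L (x s)) (Ici 0) :=
  hd.continuous.comp_continuousOn hx.continuousOn

lemma antitoneOn_energy (hx : IsGradientFlow L x) (hd : Differentiable ℝ L) :
    AntitoneOn (fun s => L (x s)) (Ici 0) :=
  antitoneOn_of_hasDerivWithinAt_nonpos (convex_Ici 0) (hx.continuousOn_energy hd)
    (fun _ ht => (hx.hasDerivWithinAt_energy hd (interior_subset ht)).mono interior_subset)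
    fun _ _ => neg_nonpos.2 (sq_nonneg _)

/-- Once the energy vanishes, the trajectory is stationary. -/
lemma eq_of_energy_eq_zero (hx : IsGradientFlow L x) (hd : Differentiable ℝ L)
    (hL : ∀ z, 0 ≤ L z) {s t : ℝ} (hs : 0 ≤ s) (hst : s ≤ t) (h : L (x s) = 0) : x t = x s := by
  refine constant_of_has_deriv_right_zero (f := x) (a := s) (b := t)
    (hx.continuousOn.mono fun r hr => hs.trans hr.1) (fun r hr => ?_) t ⟨hst, le_rfl⟩
  have hr0 : 0 ≤ r := hs.trans hr.1
  have hz : L (x r) = 0 :=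
    le_antisymm (h ▸ hx.antitoneOn_energy hd hs hr0 hr.1) (hL _)
  simpa [gradient_eq_zero_of_eq_zero hL hz] using
    (hx r hr0).mono (Ici_subset_Ici.2 hr0)

lemma energy_pos_of_le (hx : IsGradientFlow L x) (hd : Differentiable ℝ L) {s t : ℝ}
    (hs : 0 ≤ s) (hst : s ≤ t) (ht : 0 < L (x t)) : 0 < L (x s) :=
  ht.trans_le (hx.antitoneOn_energy hd hs (hs.trans hst) hst)

lemma hasDerivWithinAt_sqrt_energy (hx : IsGradientFlow L x) (hd : Differentiable ℝ L) (c a : ℝ)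
    {t : ℝ} (ht : 0 ≤ t) (h : 0 < L (x t)) :
    HasDerivWithinAt (fun s => 2 / c * (a - √(L (x s))))
      (‖gradient L (x t)‖ ^ 2 / (c * √(L (x t)))) (Ici t) t := by
  have h1 := (((hx.hasDerivWithinAt_energy hd ht).mono (Ici_subset_Ici.2 ht)).sqrt
    h.ne').const_sub a |>.const_mul (2 / c)
  convert! h1 using 1
  have := Real.sqrt_pos.2 h
  rcases eq_or_ne c 0 with rfl | hc
  · simp
  · field_simp

lemma continuousOn_sqrt_energy (hx : IsGradientFlow L x) (hd : Differentiable ℝ L) (c a : ℝ) :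
    ContinuousOn (fun s => 2 / c * (a - √(L (x s)))) (Ici 0) :=
  continuousOn_const.mul (continuousOn_const.sub (hx.continuousOn_energy hd).sqrt)

/-- If the Łojasiewicz inequality holds along `[s, t)`, the displacement over `[s, t]` is
controlled by the decrease of the square root of the energy. -/
lemma norm_sub_le (hx : IsGradientFlow L x) (hd : Differentiable ℝ L) {c s t : ℝ} (hc : 0 < c)
    (hs : 0 ≤ s) (hst : s ≤ t) (ht : 0 < L (x t))
    (hLoj : ∀ r ∈ Ico s t, c * √(L (x r)) ≤ ‖gradient L (x r)‖) :
    ‖x t - x s‖ ≤ 2 / c * (√(L (x s)) - √(L (x t))) := by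
  refine image_norm_le_of_norm_deriv_right_le_deriv_boundary'
    (f := fun r => x r - x s) (B := fun r => 2 / c * (√(L (x s)) - √(L (x r))))
    ((hx.continuousOn.mono fun r hr => hs.trans hr.1).sub continuousOn_const)
    (fun r hr => ((hx r (hs.trans hr.1)).mono
      (Ici_subset_Ici.2 (hs.trans hr.1))).sub_const (x s)) (by simp)
    ((hx.continuousOn_sqrt_energy hd c _).mono fun r hr => hs.trans hr.1)
    (fun r hr => hx.hasDerivWithinAt_sqrt_energy hd c _ (hs.trans hr.1)
      (hx.energy_pos_of_le hd (hs.trans hr.1) hr.2.le ht)) (fun r hr => ?_) ⟨hst, le_rfl⟩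
  have := Real.sqrt_pos.2 (hx.energy_pos_of_le hd (hs.trans hr.1) hr.2.le ht)
  rw [norm_neg, le_div_iff₀ (by positivity), sq]
  exact mul_le_mul_of_nonneg_left (hLoj r hr) (norm_nonneg _)

variable {R c : ℝ}

/-- As long as the energy is positive, the trajectory stays in the ball on which the
Łojasiewicz inequality is assumed. -/
lemma norm_sub_le_of_energy_pos (hx : IsGradientFlow L x) (hd : Differentiable ℝ L) (hc : 0 < c)
    (hLoj : ∀ z, ‖z - x 0‖ ≤ R → c * √(L z) ≤ ‖gradient L z‖)
    (hinit : 2 * √(L (x 0)) ≤ c * R) {t : ℝ} (ht0 : 0 ≤ t) (ht : 0 < L (x t)) :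
    ‖x t - x 0‖ ≤ R := by
  have hm : 0 < √(L (x t)) := Real.sqrt_pos.2 ht
  obtain ⟨δ, hδ, hδt⟩ : ∃ δ > 0, δ * t ≤ 2 / c * √(L (x t)) := by
    refine ⟨2 / c * √(L (x t)) / (t + 1), by positivity, ?_⟩
    rw [div_mul_eq_mul_div, div_le_iff₀ (by positivity)]
    exact mul_le_mul_of_nonneg_left (by linarith) (by positivity)
  have hR : 2 / c * √(L (x 0)) ≤ R := by
    rw [div_mul_eq_mul_div, div_le_iff₀ hc]; linarith
  have hB : ∀ r ∈ Icc 0 t, 2 / c * (√(L (x 0)) - √(L (x r))) + δ * r ≤ R := by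
    intro r hr
    have h1 : 2 / c * √(L (x t)) ≤ 2 / c * √(L (x r)) :=
      mul_le_mul_of_nonneg_left
        (Real.sqrt_le_sqrt (hx.antitoneOn_energy hd hr.1 ht0 hr.2)) (by positivity)
    have h2 : δ * r ≤ δ * t := mul_le_mul_of_nonneg_left hr.2 hδ.le
    rw [mul_sub]; linarith
  refine le_trans ?_ (hB t ⟨ht0, le_rfl⟩)
  refine image_norm_le_of_norm_deriv_right_lt_deriv_boundary'
    (f := fun r => x r - x 0) (B := fun r => 2 / c * (√(L (x 0)) - √(L (x r))) + δ * r)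
    ((hx.continuousOn.mono fun r hr => hr.1).sub continuousOn_const)
    (fun r hr => ((hx r hr.1).mono (Ici_subset_Ici.2 hr.1)).sub_const (x 0)) (by simp)
    (((hx.continuousOn_sqrt_energy hd c _).mono fun r hr => hr.1).add (by fun_prop))
    (fun r hr => (hx.hasDerivWithinAt_sqrt_energy hd c _ hr.1
      (hx.energy_pos_of_le hd hr.1 hr.2.le ht)).add
        ((hasDerivWithinAt_id r _).const_mul δ)) (fun r hr heq => ?_) ⟨ht0, le_rfl⟩
  have := Real.sqrt_pos.2 (hx.energy_pos_of_le hd hr.1 hr.2.le ht)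
  have key : ‖gradient L (x r)‖ ≤ ‖gradient L (x r)‖ ^ 2 / (c * √(L (x r))) := by
    rw [le_div_iff₀ (by positivity), sq]
    exact mul_le_mul_of_nonneg_left
      (hLoj _ (heq.trans_le (hB r ⟨hr.1, hr.2.le⟩))) (norm_nonneg _)
  rw [norm_neg]
  linarith

lemma norm_sub_le_radius (hx : IsGradientFlow L x) (hd : Differentiable ℝ L)
    (hL : ∀ z, 0 ≤ L z) (hR : 0 < R) (hc : 0 < c)
    (hLoj : ∀ z, ‖z - x 0‖ ≤ R → c * √(L z) ≤ ‖gradient L z‖)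
    (hinit : 2 * √(L (x 0)) ≤ c * R) {t : ℝ} (ht0 : 0 ≤ t) : ‖x t - x 0‖ ≤ R := by
  rcases (hL (x t)).lt_or_eq with ht | ht
  · exact hx.norm_sub_le_of_energy_pos hd hc hLoj hinit ht0 ht
  set S : Set ℝ := Ici 0 ∩ (fun s => L (x s)) ⁻¹' {0}
  have hS : IsClosed S :=
    (hx.continuousOn_energy hd).preimage_isClosed_of_isClosed isClosed_Ici isClosed_singleton
  have hbdd : BddBelow S := ⟨0, fun s hs => hs.1⟩
  have htS : t ∈ S := ⟨ht0, ht.symm⟩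
  obtain ⟨hT0, hT⟩ := hS.csInf_mem ⟨t, htS⟩ hbdd
  rw [hx.eq_of_energy_eq_zero hd hL hT0 (csInf_le hbdd htS) hT]
  rcases (mem_Ici.1 hT0).eq_or_lt with h0 | h0
  · simpa [← h0] using hR.le
  have hcl : closure (Ico 0 (sInf S)) = Icc 0 (sInf S) := closure_Ico h0.ne
  refine le_on_closure (s := Ico 0 (sInf S)) (f := fun r => ‖x r - x 0‖) (g := fun _ => R)
    (fun r hr => ?_) ?_ continuousOn_const (hcl ▸ ⟨h0.le, le_rfl⟩)
  · refine hx.norm_sub_le_of_energy_pos hd hc hLoj hinit hr.1 ((hL _).lt_of_ne' fun h => ?_)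
    exact hr.2.not_ge (csInf_le hbdd ⟨hr.1, h⟩)
  · rw [hcl]
    exact ((hx.continuousOn.mono fun r hr => hr.1).sub continuousOn_const).norm

/-- Exponential decay of the energy under the Łojasiewicz inequality along the trajectory. -/
lemma energy_le_exp (hx : IsGradientFlow L x) (hd : Differentiable ℝ L)
    (hL : ∀ z, 0 ≤ L z) (hc : 0 < c)
    (hLoj : ∀ t, 0 ≤ t → c * √(L (x t)) ≤ ‖gradient L (x t)‖) {t : ℝ} (ht : 0 ≤ t) :
    L (x t) ≤ L (x 0) * Real.exp (-(c ^ 2 * t)) := by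
  have hanti : AntitoneOn (fun s => L (x s) * Real.exp (c ^ 2 * s)) (Ici 0) := by
    refine antitoneOn_of_hasDerivWithinAt_nonpos (convex_Ici 0)
      ((hx.continuousOn_energy hd).mul (by fun_prop))
      (fun s hs => ((hx.hasDerivWithinAt_energy hd (interior_subset hs)).mul
        ((hasDerivWithinAt_id s _).const_mul (c ^ 2)).exp).mono interior_subset) fun s hs => ?_
    have h : c ^ 2 * L (x s) ≤ ‖gradient L (x s)‖ ^ 2 := by
      have := pow_le_pow_left₀ (by positivity) (hLoj s (interior_subset hs)) 2
      rwa [mul_pow, Real.sq_sqrt (hL _)] at this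
    have := mul_le_mul_of_nonneg_right h (Real.exp_pos (c ^ 2 * s)).le
    simp only [id, mul_one]
    linarith
  have h := hanti self_mem_Ici ht ht
  rw [Real.exp_neg, ← div_eq_mul_inv, le_div_iff₀ (Real.exp_pos _)]
  simpa using h

lemma tendsto_energy (hx : IsGradientFlow L x) (hd : Differentiable ℝ L)
    (hL : ∀ z, 0 ≤ L z) (hc : 0 < c)
    (hLoj : ∀ t, 0 ≤ t → c * √(L (x t)) ≤ ‖gradient L (x t)‖) :
    Tendsto (fun t => L (x t)) atTop (𝓝 0) := by
  have h : Tendsto (fun t => L (x 0) * Real.exp (-(c ^ 2 * t))) atTop (𝓝 0) := by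
    simpa using (Real.tendsto_exp_neg_atTop_nhds_zero.comp
      (tendsto_id.const_mul_atTop (pow_pos hc 2))).const_mul (L (x 0))
  refine squeeze_zero' (Eventually.of_forall fun _ => hL _) ?_ h
  filter_upwards [eventually_ge_atTop 0] with t ht
  exact hx.energy_le_exp hd hL hc hLoj ht

/-- A trajectory along which the Łojasiewicz inequality holds converges. -/
lemma exists_tendsto (hx : IsGradientFlow L x) (hd : Differentiable ℝ L)
    (hL : ∀ z, 0 ≤ L z) (hc : 0 < c)
    (hLoj : ∀ t, 0 ≤ t → c * √(L (x t)) ≤ ‖gradient L (x t)‖) :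
    ∃ y, Tendsto x atTop (𝓝 y) := by
  by_cases hzero : ∃ T, 0 ≤ T ∧ L (x T) = 0
  · obtain ⟨T, hT0, hT⟩ := hzero
    refine ⟨x T, tendsto_const_nhds.congr' ?_⟩
    filter_upwards [eventually_ge_atTop T] with t ht
    exact (hx.eq_of_energy_eq_zero hd hL hT0 ht hT).symm
  push Not at hzero
  have hdist : ∀ s t, 0 ≤ s → s ≤ t → dist (x t) (x s) ≤ 2 / c * √(L (x s)) := by
    intro s t hs hst
    rw [dist_eq_norm]
    refine (hx.norm_sub_le hd hc hs hst ((hL _).lt_of_ne' (hzero t (hs.trans hst)))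
      fun r hr => hLoj r (hs.trans hr.1)).trans ?_
    exact mul_le_mul_of_nonneg_left (sub_le_self _ (Real.sqrt_nonneg _)) (by positivity)
  have hlim : Tendsto (fun t => 2 / c * √(L (x t))) atTop (𝓝 0) := by
    simpa using ((hx.tendsto_energy hd hL hc hLoj).sqrt).const_mul (2 / c)
  refine cauchySeq_tendsto_of_complete (Metric.cauchySeq_iff'.2 fun ε hε => ?_)
  obtain ⟨N, hN, hN0⟩ := ((hlim.eventually (gt_mem_nhds hε)).and
    (eventually_ge_atTop 0)).exists
  exact ⟨N, fun t ht => (hdist N t hN0 ht).trans_lt hN⟩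

end IsGradientFlow

end GradientFlow


/-- (Local convergence criterion.) If `L : H → [0,∞)` is C²,
`‖∇L(z)‖ ≥ c √(L(z))` for all `z` with `‖z - x₀‖ ≤ R`, and `2√(L(x₀)) ≤ cR`, then every
gradient-flow trajectory of `L` started at `x₀` converges to some `x_∞` with
`‖x_∞ - x₀‖ ≤ R` and `L(x_∞) = 0`. -/
theorem stmt_6 {H : Type*} [NormedAddCommGroup H] [InnerProductSpace ℝ H] [CompleteSpace H]
    (L : H → ℝ) (hL_nonneg : ∀ z, 0 ≤ L z) (hL : ContDiff ℝ 2 L)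
    (x₀ : H) (R c : ℝ) (hR : 0 < R) (hc : 0 < c)
    (hLoj : ∀ z : H, ‖z - x₀‖ ≤ R → c * Real.sqrt (L z) ≤ ‖gradient L z‖)
    (hinit : 2 * Real.sqrt (L x₀) ≤ c * R)
    (x : ℝ → H) (hx0 : x 0 = x₀)
    (hx : ∀ t ∈ Set.Ici (0 : ℝ), HasDerivWithinAt x (-gradient L (x t)) (Set.Ici 0) t) :
    ∃ xinf : H, ‖xinf - x₀‖ ≤ R ∧ L xinf = 0 ∧
      Filter.Tendsto x Filter.atTop (nhds xinf) := by
  subst hx0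
  have hflow : IsGradientFlow L x := hx
  have hd : Differentiable ℝ L := hL.differentiable two_ne_zero
  have hball : ∀ t, 0 ≤ t → ‖x t - x 0‖ ≤ R := fun t ht =>
    hflow.norm_sub_le_radius hd hL_nonneg hR hc hLoj hinit ht
  have hLoj' : ∀ t, 0 ≤ t → c * √(L (x t)) ≤ ‖gradient L (x t)‖ := fun t ht =>
    hLoj _ (hball t ht)
  obtain ⟨y, hy⟩ := hflow.exists_tendsto hd hL_nonneg hc hLoj'
  refine ⟨y, ?_, ?_, hy⟩
  · exact le_of_tendsto (hy.sub_const (x 0)).norm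
      ((eventually_ge_atTop 0).mono hball)
  · exact tendsto_nhds_unique ((hd.continuous.tendsto y).comp hy)
      (hflow.tendsto_energy hd hL_nonneg hc hLoj')
end

section
/- Let H be a real Hilbert space and L : H → [0,∞) be twice continuously Fréchet differentiable, and assume there exists c > 0 such that ‖∇L(x)‖ ≥ c·√(L(x))/(1 + ‖x‖) for every x ∈ H. Then every gradient-flow trajectory x : [0,∞) → H of L starting at 0 converges: there exists x_∞ ∈ H with ‖x_∞‖ ≤ e^{(2/c)√(L(0))} − 1 and L(x_∞) = 0 such that x(t) → x_∞ in H as t → ∞. -/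
open Filter Topology Set in
/-- A real function with nonpositive right derivative on `[a, ∞)` is antitone there. -/
theorem antitoneOn_Ici_of_hasDerivWithinAt_nonpos {a : ℝ} {f f' : ℝ → ℝ}
    (hc : ContinuousOn f (Ici a)) (hf : ∀ t ∈ Ici a, HasDerivWithinAt f (f' t) (Ici t) t)
    (hf' : ∀ t ∈ Ici a, f' t ≤ 0) : AntitoneOn f (Ici a) := by
  intro u hu t _ hut
  have hu' : a ≤ u := hu
  refine image_le_of_deriv_right_le_deriv_boundary (f' := f') (B := fun _ => f u)
    (B' := fun _ => 0) (hc.mono fun r hr => hu'.trans hr.1)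
    (fun r hr => hf r (hu'.trans hr.1)) le_rfl continuousOn_const
    (fun r _ => hasDerivWithinAt_const _ _ _) (fun r hr => hf' r (hu'.trans hr.1))
    (right_mem_Icc.2 hut)

open Filter Topology Set in
/-- A curve of finite length converges: if the displacement of `x` is
controlled by the increments of a bounded function `s`, then `x` has a limit at infinity. -/
theorem exists_tendsto_of_norm_sub_le {E : Type*} [NormedAddCommGroup E]
    [CompleteSpace E] {x : ℝ → E} {s : ℝ → ℝ} {B : ℝ}
    (hdist : ∀ u t, 0 ≤ u → u ≤ t → ‖x t - x u‖ ≤ s t - s u) (hB : ∀ t, 0 ≤ t → s t ≤ B) :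
    ∃ y, Tendsto x atTop (𝓝 y) := by
  have hmono : Monotone fun t => s (max t 0) := by
    intro u t hut
    have := (norm_nonneg _).trans
      (hdist (max u 0) (max t 0) (le_max_right _ _) (max_le_max_right 0 hut))
    simpa using this
  have hs : CauchySeq fun t => s (max t 0) :=
    (tendsto_atTop_ciSup hmono
      ⟨B, by rintro _ ⟨t, rfl⟩; exact hB _ (le_max_right _ _)⟩).cauchySeq
  refine cauchySeq_tendsto_of_complete (Metric.cauchySeq_iff'.2 fun ε hε => ?_)
  obtain ⟨N, hN⟩ := Metric.cauchySeq_iff'.1 hs ε hε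
  refine ⟨max N 0, fun t ht => ?_⟩
  have ht0 : 0 ≤ t := (le_max_right N 0).trans ht
  have h := hN t ((le_max_left N 0).trans ht)
  rw [Real.dist_eq, max_eq_left ht0] at h
  rw [dist_eq_norm]
  exact (hdist _ _ (le_max_right _ _) ht).trans_lt ((le_abs_self _).trans_lt h)

/-- If `L : H → [0,∞)` is C² and `‖∇L(z)‖ ≥ c √(L(z))/(1 + ‖z‖)` for
every `z` (with `c > 0`), then every gradient-flow trajectory of `L` started at `0`
converges to some `x_∞` with `‖x_∞‖ ≤ e^{(2/c)√(L(0))} - 1` and `L(x_∞) = 0`. -/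
theorem stmt_7 {H : Type*} [NormedAddCommGroup H] [InnerProductSpace ℝ H] [CompleteSpace H]
    (L : H → ℝ) (hL_nonneg : ∀ z, 0 ≤ L z) (hL : ContDiff ℝ 2 L)
    (c : ℝ) (hc : 0 < c)
    (hLoj : ∀ z : H, c * Real.sqrt (L z) / (1 + ‖z‖) ≤ ‖gradient L z‖)
    (x : ℝ → H) (hx0 : x 0 = 0)
    (hx : ∀ t ∈ Set.Ici (0 : ℝ), HasDerivWithinAt x (-gradient L (x t)) (Set.Ici 0) t) :
    ∃ xinf : H, ‖xinf‖ ≤ Real.exp ((2 / c) * Real.sqrt (L 0)) - 1 ∧ L xinf = 0 ∧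
      Filter.Tendsto x Filter.atTop (nhds xinf) := by
  have hdiff : Differentiable ℝ L := hL.differentiable (by norm_num)
  have hgradc : Continuous (gradient L) :=
    (InnerProductSpace.toDual ℝ H).symm.continuous.comp (hL.continuous_fderiv (by norm_num))
  have hxc : ContinuousOn x (Set.Ici 0) := fun t ht => (hx t ht).continuousWithinAt
  have hxr : ∀ t ∈ Set.Ici (0 : ℝ), HasDerivWithinAt x (-gradient L (x t)) (Set.Ici t) t :=
    fun t ht => (hx t ht).mono (Set.Ici_subset_Ici.2 ht)
  -- the arc length
  set G : ℝ → ℝ := fun t => ‖gradient L (x (max t 0))‖ with hG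
  have hGc : Continuous G := by
    refine (hgradc.comp ?_).norm
    exact hxc.comp_continuous (continuous_id.max continuous_const) fun t => le_max_right t 0
  have hGt : ∀ t, 0 ≤ t → G t = ‖gradient L (x t)‖ := fun t ht => by simp [hG, max_eq_left ht]
  set s : ℝ → ℝ := fun t => ∫ r in (0 : ℝ)..t, G r with hs
  have hs0 : s 0 = 0 := by simp [hs]
  have hsd : ∀ t, HasDerivAt s (G t) t := fun t => hGc.integral_hasStrictDerivAt 0 t |>.hasDerivAt
  have hsc : Continuous s := continuous_iff_continuousAt.2 fun t => (hsd t).continuousAt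
  have hdist : ∀ u t, 0 ≤ u → u ≤ t → ‖x t - x u‖ ≤ s t - s u := by
    intro u t hu hut
    refine image_norm_le_of_norm_deriv_right_le_deriv_boundary (f := fun r => x r - x u)
      (B := fun r => s r - s u) (f' := fun r => -gradient L (x r)) (B' := G)
      ((hxc.mono fun r hr => hu.trans hr.1).sub continuousOn_const)
      (fun r hr => (hxr r (hu.trans hr.1)).sub_const _) (by simp)
      (fun r => (hsd r).sub_const _) (fun r hr => ?_) (Set.right_mem_Icc.2 hut)
    rw [norm_neg, hGt r (hu.trans hr.1)]
  have hxs : ∀ t, 0 ≤ t → ‖x t‖ ≤ s t := fun t ht => by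
    simpa [hx0, hs0] using hdist 0 t le_rfl ht
  -- the loss decreases along the trajectory
  have hld : ∀ t ∈ Set.Ici (0 : ℝ),
      HasDerivWithinAt (fun r => L (x r)) (-(G t) ^ 2) (Set.Ici t) t := by
    intro t ht
    have h := (hdiff (x t)).hasGradientAt.hasFDerivAt.comp_hasDerivWithinAt t (hxr t ht)
    rw [InnerProductSpace.toDual_apply_apply, inner_neg_right, real_inner_self_eq_norm_sq,
      ← hGt t ht] at h
    exact h
  have hlc : ContinuousOn (fun r => L (x r)) (Set.Ici 0) := hL.continuous.comp_continuousOn hxc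
  have hanti : AntitoneOn (fun r => L (x r)) (Set.Ici 0) :=
    antitoneOn_Ici_of_hasDerivWithinAt_nonpos hlc hld fun t _ => by
      simpa using sq_nonneg (G t)
  have hGL : ∀ t, 0 ≤ t → c * √(L (x t)) / (1 + s t) ≤ G t := by
    intro t ht
    rw [hGt t ht]
    refine le_trans ?_ (hLoj (x t))
    have := hxs t ht
    gcongr
  -- the Lyapunov function
  set φ : ℝ → ℝ := fun t => Real.log (1 + s t) + 2 / c * √(L (x t)) with hφ
  have hpos : ∀ t, 0 ≤ t → 0 < 1 + s t := fun t ht => by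
    linarith [hxs t ht, norm_nonneg (x t)]
  have hφc : ContinuousOn φ (Set.Ici 0) :=
    ((continuous_const.add hsc).continuousOn.log fun t ht => (hpos t ht).ne').add
      (continuousOn_const.mul hlc.sqrt)
  have hlog : ∀ t, 0 ≤ t → HasDerivWithinAt (fun r => Real.log (1 + s r)) (G t / (1 + s t))
      (Set.Ici t) t := fun t ht =>
    (((hsd t).const_add 1).log (hpos t ht).ne').hasDerivWithinAt
  have hφd : ∀ t ∈ Set.Ici (0 : ℝ), ∃ d ≤ 0, HasDerivWithinAt φ d (Set.Ici t) t := by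
    intro t ht
    rcases (hL_nonneg (x t)).eq_or_lt with h0 | h0
    · have hG0 : G t = 0 := by
        have hmin : IsLocalMin L (x t) :=
          Filter.Eventually.of_forall fun z => by simpa [← h0] using hL_nonneg z
        rw [hGt t ht, gradient, hmin.fderiv_eq_zero, map_zero, norm_zero]
      refine ⟨0, le_rfl, ?_⟩
      have hz : ∀ r ∈ Set.Ici t, φ r = Real.log (1 + s r) := fun r hr => by
        have hr' : t ≤ r := hr
        have h1 : L (x r) ≤ L (x t) := hanti ht (le_trans ht hr') hr'
        simp [hφ, Real.sqrt_eq_zero_of_nonpos (h1.trans h0.symm.le)]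
      have := hlog t ht
      rw [hG0, zero_div] at this
      exact this.congr hz (hz t Set.self_mem_Ici)
    · refine ⟨_, ?_, (hlog t ht).add (((hld t ht).sqrt h0.ne').const_mul (2 / c))⟩
      have hq : 0 < √(L (x t)) := Real.sqrt_pos.2 h0
      have hG0 : 0 ≤ G t := norm_nonneg _
      have h1 : c * √(L (x t)) ≤ G t * (1 + s t) := (div_le_iff₀ (hpos t ht)).1 (hGL t ht)
      have h2 : G t / (1 + s t) + 2 / c * (-(G t) ^ 2 / (2 * √(L (x t)))) =
          G t * (c * √(L (x t)) - G t * (1 + s t)) / (c * √(L (x t)) * (1 + s t)) := by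
        have := (hpos t ht).ne'
        field_simp
        ring
      rw [h2]
      refine div_nonpos_of_nonpos_of_nonneg ?_ (by have := hpos t ht; positivity)
      exact mul_nonpos_of_nonneg_of_nonpos hG0 (by linarith)
  choose! φ' hφ'0 hφ' using hφd
  have hφanti := antitoneOn_Ici_of_hasDerivWithinAt_nonpos hφc hφ' hφ'0
  have hsB : ∀ t, 0 ≤ t → s t ≤ Real.exp (2 / c * √(L 0)) - 1 := by
    intro t ht
    have h1 : φ t ≤ φ 0 := hφanti Set.self_mem_Ici ht ht
    simp only [hφ, hs0, hx0, add_zero, Real.log_one, zero_add] at h1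
    have h2 : Real.log (1 + s t) ≤ 2 / c * √(L 0) := by
      have : 0 ≤ 2 / c * √(L (x t)) := by positivity
      linarith
    linarith [(Real.log_le_iff_le_exp (hpos t ht)).1 h2]
  obtain ⟨y, hy⟩ := exists_tendsto_of_norm_sub_le hdist hsB
  refine ⟨y, ?_, ?_, hy⟩
  · refine le_of_tendsto hy.norm ((Filter.eventually_ge_atTop 0).mono fun t ht => ?_)
    exact (hxs t ht).trans (hsB t ht)
  by_contra hne
  have hLy : 0 < L y := (hL_nonneg y).lt_of_ne' hne
  have hle : ∀ t, 0 ≤ t → L y ≤ L (x t) := fun t ht =>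
    le_of_tendsto ((hL.continuous.tendsto y).comp hy)
      ((Filter.eventually_ge_atTop t).mono fun r hr => hanti ht (le_trans ht hr) hr)
  set E := Real.exp (2 / c * √(L 0)) with hE
  have hEpos : 0 < E := Real.exp_pos _
  set k := c * √(L y) / E with hk
  have hkpos : 0 < k := by positivity
  have hGk : ∀ t, 0 ≤ t → k ≤ G t := fun t ht => by
    refine le_trans ?_ (hGL t ht)
    have h1 := hsB t ht
    have h2 := hle t ht
    have h3 := hpos t ht
    have h4 : 1 + s t ≤ E := by linarith
    rw [hk]
    gcongr
  have hlin : ∀ t, 0 ≤ t → k * t - s t ≤ k * 0 - s 0 := fun t ht =>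
    antitoneOn_Ici_of_hasDerivWithinAt_nonpos (f := fun r => k * r - s r)
      (f' := fun r => k * 1 - G r)
      ((continuous_const.mul continuous_id).sub hsc).continuousOn
      (fun r _ => (((hasDerivAt_id r).const_mul k).sub (hsd r)).hasDerivWithinAt)
      (fun r hr => by linarith [hGk r hr]) Set.self_mem_Ici ht ht
  have hEk : 0 ≤ E / k := by positivity
  have h1 := hlin (E / k) hEk
  have h2 := hsB (E / k) hEk
  rw [mul_div_cancel₀ E hkpos.ne', hs0] at h1
  linarith
end

section
/- Let H be a real Hilbert space, E a real normed vector space, and ι : H → E an injective continuous linear map that is compact (ι maps bounded subsets of H to relatively compact subsets of E). Let (Hₙ)_{n ≥ 0} be a nondecreasing sequence of closed subspaces of H whose union is dense in H, and let πₙ : H → H denote the orthogonal projection onto Hₙ. Then sup_{‖h‖_H ≤ 1} ‖ι(h − πₙ(h))‖_E → 0 as n → ∞. -/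
open InnerProductSpace in
/-- If `y` lies in the closure of the image under `ι` of `{x ∈ (K n)ᗮ | ‖x‖ ≤ 1}` for every `n`,
and the union of the `K n` is dense, then `y = 0`. -/
lemma eq_zero_of_forall_mem_closure_image_orthogonal {H : Type*} [NormedAddCommGroup H]
    [InnerProductSpace ℝ H] [CompleteSpace H] {E : Type*} [NormedAddCommGroup E] [NormedSpace ℝ E]
    (ι : H →L[ℝ] E) {κ : Type*} (K : κ → Submodule ℝ H) (hdense : Dense (⋃ n, (K n : Set H)))
    {y : E} (hy : ∀ n, y ∈ closure (ι '' {x | x ∈ (K n)ᗮ ∧ ‖x‖ ≤ 1})) : y = 0 := by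
  refine SeparatingDual.eq_zero_of_forall_dual_eq_zero (R := ℝ) fun f => ?_
  rw [← norm_le_zero_iff]
  refine le_of_forall_pos_le_add fun δ hδ => ?_
  rw [zero_add]
  set v : H := (toDual ℝ H).symm (f.comp ι) with hv
  obtain ⟨k, hk, hvk⟩ := Metric.dense_iff.1 hdense v δ hδ
  obtain ⟨n, hkn⟩ := Set.mem_iUnion.1 hvk
  have hclosed : IsClosed {z : E | ‖f z‖ ≤ δ} := isClosed_le (by fun_prop) continuous_const
  refine closure_minimal ?_ hclosed (hy n)
  rintro _ ⟨x, ⟨hx, hx1⟩, rfl⟩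
  have hfx : f (ι x) = inner ℝ (v - k) x := by
    rw [inner_sub_left, (Submodule.mem_orthogonal _ _).1 hx k hkn, sub_zero, hv,
      toDual_symm_apply]
    rfl
  have hdist : ‖v - k‖ < δ := by
    rwa [Metric.mem_ball, dist_comm, dist_eq_norm] at hk
  change ‖f (ι x)‖ ≤ δ
  rw [hfx]
  calc ‖inner ℝ (v - k) x‖ ≤ ‖v - k‖ * ‖x‖ := norm_inner_le_norm _ _
    _ ≤ δ * 1 := by gcongr
    _ = δ := mul_one δ

/-- A vector with an orthogonal splitting along `K` is at least as long as its component in `Kᗮ`. -/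
lemma norm_sub_le_of_mem_of_sub_mem_orthogonal {H : Type*} [NormedAddCommGroup H]
    [InnerProductSpace ℝ H] {K : Submodule ℝ H} {h q : H} (hq : q ∈ K) (hhq : h - q ∈ Kᗮ) :
    ‖h - q‖ ≤ ‖h‖ := by
  have hpyth := norm_add_sq_eq_norm_sq_add_norm_sq_real ((Submodule.mem_orthogonal _ _).1 hhq q hq)
  rw [add_sub_cancel] at hpyth
  nlinarith [norm_nonneg h, norm_nonneg q, norm_nonneg (h - q)]

/-- Let `ι : H → E` be an injective compact continuous linear map from
a real Hilbert space to a normed space, and `(Kₙ)` a nondecreasing sequence of closed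
subspaces of `H` with dense union. If `pₙ : H → H` is the orthogonal projection onto
`Kₙ` (characterized by `pₙ h ∈ Kₙ` and `h - pₙ h ⊥ Kₙ`), then
`sup_{‖h‖ ≤ 1} ‖ι(h - pₙ h)‖ → 0` as `n → ∞`. -/
theorem stmt_15 {H : Type*} [NormedAddCommGroup H] [InnerProductSpace ℝ H] [CompleteSpace H]
    {E : Type*} [NormedAddCommGroup E] [NormedSpace ℝ E]
    (ι : H →L[ℝ] E) (hinj : Function.Injective ι)
    (hcpt : ∀ s : Set H, Bornology.IsBounded s → IsCompact (closure (ι '' s)))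
    (K : ℕ → Submodule ℝ H) (hclosed : ∀ n, IsClosed (K n : Set H)) (hmono : Monotone K)
    (hdense : Dense (⋃ n, (K n : Set H)))
    (p : ℕ → H → H) (hp : ∀ n h, p n h ∈ K n ∧ h - p n h ∈ (K n)ᗮ) :
    Filter.Tendsto (fun n => ⨆ h : {z : H // ‖z‖ ≤ 1}, ‖ι ((h : H) - p n h)‖)
      Filter.atTop (nhds 0) := by
  set A : ℕ → Set H := fun n => {x | x ∈ (K n)ᗮ ∧ ‖x‖ ≤ 1} with hA
  have hAanti : Antitone A := fun m n hmn x hx =>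
    ⟨Submodule.orthogonal_le (hmono hmn) hx.1, hx.2⟩
  have hAcpt : ∀ n, IsCompact (closure (ι '' A n)) := fun n =>
    hcpt _ (Metric.isBounded_closedBall.subset fun x hx => mem_closedBall_zero_iff.2 hx.2)
  have hmem : ∀ n h, ‖h‖ ≤ 1 → h - p n h ∈ A n := fun n h hh =>
    ⟨(hp n h).2, (norm_sub_le_of_mem_of_sub_mem_orthogonal (hp n h).1 (hp n h).2).trans hh⟩
  have hsmall : ∀ ε > 0, ∃ N, ∀ x ∈ A N, ‖ι x‖ < ε := by
    intro ε hε
    by_contra! hcon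
    have hfar : IsClosed {z : E | ε ≤ ‖z‖} := isClosed_le continuous_const continuous_norm
    obtain ⟨y, hy⟩ := IsCompact.nonempty_iInter_of_sequence_nonempty_isCompact_isClosed
      (fun n => closure (ι '' A n) ∩ {z : E | ε ≤ ‖z‖})
      (fun n => Set.inter_subset_inter_left _
        (closure_mono (Set.image_mono (hAanti n.le_succ))))
      (fun n => by
        obtain ⟨x, hx, hεx⟩ := hcon n
        exact ⟨ι x, subset_closure ⟨x, hx, rfl⟩, hεx⟩)
      ((hAcpt 0).inter_right hfar) (fun n => isClosed_closure.inter hfar)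
    rw [Set.mem_iInter] at hy
    have hy0 := eq_zero_of_forall_mem_closure_image_orthogonal ι K hdense fun n => (hy n).1
    have hεy : ε ≤ ‖y‖ := (hy 0).2
    rw [hy0, norm_zero] at hεy
    exact hεy.not_gt hε
  rw [Metric.tendsto_atTop]
  intro ε hε
  obtain ⟨N, hN⟩ := hsmall (ε / 2) (half_pos hε)
  refine ⟨N, fun n hn => ?_⟩
  rw [Real.dist_0_eq_abs, abs_of_nonneg (Real.iSup_nonneg fun _ => norm_nonneg _)]
  refine (Real.iSup_le (fun h => ?_) (half_pos hε).le).trans_lt (half_lt_self hε)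
  exact (hN _ (hAanti hn (hmem n h h.2))).le
end

section
/- Let δ ∈ (1/2, 1) and for η ∈ (0,1) define φ_η : [0,1] → ℝ by φ_η(s) = max(0, 1 − (1−s)/η). Then there exists a constant C > 0, depending only on δ, such that ‖φ_η‖_{H^δ} ≤ C η^{1/2 − δ} for all η ∈ (0,1). -/
open MeasureTheory
open scoped ENNReal

/-- The square of the Sobolev–Slobodeckij seminorm of a real path on `[0,1]`,
for `0 < γ < 1` (valued in `ℝ≥0∞`). -/
noncomputable def sobolevSlobodeckijSqR (γ : ℝ) (f : ℝ → ℝ) : ℝ≥0∞ :=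
  ∫⁻ t in Set.Icc (0 : ℝ) 1, ∫⁻ s in Set.Icc (0 : ℝ) t,
    ENNReal.ofReal (|f t - f s| ^ 2 / (t - s) ^ (1 + 2 * γ))

/-- Integral over `(0, η]` of the part of the kernel bound coming from the Lipschitz estimate. -/
theorem lintegral_Ioc_rpow_div_sq {δ η : ℝ} (hδ1 : δ < 1) (hη : 0 < η) :
    ∫⁻ u in Set.Ioc 0 η, ENNReal.ofReal (u ^ (1 - 2 * δ) / η ^ 2) =
      ENNReal.ofReal (η ^ (-(2 * δ)) / (2 - 2 * δ)) := by
  have hint : IntegrableOn (fun u : ℝ => u ^ (1 - 2 * δ)) (Set.Ioc 0 η) :=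
    (intervalIntegrable_iff_integrableOn_Ioc_of_le hη.le).1
      (intervalIntegral.intervalIntegrable_rpow' (by linarith))
  rw [← ofReal_integral_eq_lintegral_ofReal (hint.div_const _)]
  · congr 1
    rw [integral_div, ← intervalIntegral.integral_of_le hη.le, integral_rpow (Or.inl (by linarith)),
      Real.zero_rpow (by linarith), show 1 - 2 * δ + 1 = -(2 * δ) + 2 by ring,
      Real.rpow_add hη, Real.rpow_two]
    have : 2 - 2 * δ ≠ 0 := by linarith
    have : -(2 * δ) + 2 ≠ 0 := by linarith
    field_simp
    ring
  · filter_upwards [ae_restrict_mem measurableSet_Ioc] with u hu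
    exact div_nonneg (Real.rpow_nonneg hu.1.le _) (sq_nonneg _)

/-- Integral over `(η, ∞)` of the part of the kernel bound coming from boundedness. -/
theorem lintegral_Ioi_rpow_neg {δ η : ℝ} (hδ : 0 < δ) (hη : 0 < η) :
    ∫⁻ u in Set.Ioi η, ENNReal.ofReal (u ^ (-(1 + 2 * δ))) =
      ENNReal.ofReal (η ^ (-(2 * δ)) / (2 * δ)) := by
  rw [← ofReal_integral_eq_lintegral_ofReal (integrableOn_Ioi_rpow_of_lt (by linarith) hη)]
  · congr 1
    rw [integral_Ioi_rpow_of_lt (by linarith) hη, show -(1 + 2 * δ) + 1 = -(2 * δ) by ring,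
      neg_div_neg_eq]
  · filter_upwards [ae_restrict_mem measurableSet_Ioi] with u hu
    exact Real.rpow_nonneg (hη.trans hu).le _

/-- The inner Slobodeckij integral of a path whose increments are at most `1` and which is
`η⁻¹`-Lipschitz. -/
theorem lintegral_increment_le {δ η t : ℝ} {f : ℝ → ℝ} (hδ : 0 < δ) (hδ1 : δ < 1) (hη : 0 < η)
    (hbdd : ∀ s ≤ t, |f t - f s| ≤ 1) (hlip : ∀ s ≤ t, |f t - f s| ≤ (t - s) / η) :
    ∫⁻ s in Set.Icc (0 : ℝ) t, ENNReal.ofReal (|f t - f s| ^ 2 / (t - s) ^ (1 + 2 * δ)) ≤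
      ENNReal.ofReal (η ^ (-(2 * δ)) * (1 / (2 - 2 * δ) + 1 / (2 * δ))) := by
  let A : ℝ → ℝ≥0∞ := (Set.Ioc 0 η).indicator fun u => ENNReal.ofReal (u ^ (1 - 2 * δ) / η ^ 2)
  let B : ℝ → ℝ≥0∞ := (Set.Ioi η).indicator fun u => ENNReal.ofReal (u ^ (-(1 + 2 * δ)))
  have hA : Measurable A := by
    refine Measurable.indicator ?_ measurableSet_Ioc
    fun_prop
  have hle : ∀ s ∈ Set.Icc (0 : ℝ) t,
      ENNReal.ofReal (|f t - f s| ^ 2 / (t - s) ^ (1 + 2 * δ)) ≤ A (t - s) + B (t - s) := by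
    intro s hs
    rcases hs.2.eq_or_lt with rfl | hst
    · simp
    have hu : 0 < t - s := sub_pos.2 hst
    by_cases hcase : t - s ≤ η
    · refine le_trans ?_ le_self_add
      simp only [A, Set.indicator_of_mem (show t - s ∈ Set.Ioc 0 η from ⟨hu, hcase⟩)]
      apply ENNReal.ofReal_le_ofReal
      calc |f t - f s| ^ 2 / (t - s) ^ (1 + 2 * δ)
          ≤ ((t - s) / η) ^ 2 / (t - s) ^ (1 + 2 * δ) := by
            gcongr
            exact hlip s hs.2
        _ = (t - s) ^ (1 - 2 * δ) / η ^ 2 := by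
            rw [show 1 - 2 * δ = 2 - (1 + 2 * δ) by ring, Real.rpow_sub hu, Real.rpow_two]
            ring
    · refine le_trans ?_ le_add_self
      simp only [B, Set.indicator_of_mem (show t - s ∈ Set.Ioi η from not_le.1 hcase)]
      apply ENNReal.ofReal_le_ofReal
      rw [Real.rpow_neg hu.le, ← one_div]
      gcongr
      exact pow_le_one₀ (abs_nonneg _) (hbdd s hs.2)
  calc _ ≤ ∫⁻ s in Set.Icc (0 : ℝ) t, (A (t - s) + B (t - s)) :=
        setLIntegral_mono' measurableSet_Icc hle
    _ ≤ ∫⁻ s, (A (t - s) + B (t - s)) := setLIntegral_le_lintegral _ _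
    _ = ∫⁻ u, (A u + B u) := lintegral_sub_left_eq_self (fun u => A u + B u) t
    _ = _ := by
        rw [lintegral_add_left hA, lintegral_indicator measurableSet_Ioc,
          lintegral_indicator measurableSet_Ioi, lintegral_Ioc_rpow_div_sq hδ1 hη,
          lintegral_Ioi_rpow_neg hδ hη, ← ENNReal.ofReal_add]
        · congr 1
          ring
        · exact div_nonneg (Real.rpow_nonneg hη.le _) (by linarith)
        · positivity

/-- For `δ ∈ (1/2, 1)` and `φ_η(s) = max(0, 1 - (1-s)/η)` there is a
constant `C > 0`, depending only on `δ`, with `‖φ_η‖_{H^δ} ≤ C η^{1/2 - δ}` for all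
`η ∈ (0,1)`. -/
theorem stmt_19 (δ : ℝ) (hδ : 1 / 2 < δ) (hδ1 : δ < 1) :
    ∃ C > (0 : ℝ), ∀ η : ℝ, η ∈ Set.Ioo (0 : ℝ) 1 →
      (sobolevSlobodeckijSqR δ (fun s => max 0 (1 - (1 - s) / η))) ^ ((1 : ℝ) / 2) ≤
        ENNReal.ofReal (C * η ^ (1 / 2 - δ)) := by
  have hδ0 : 0 < δ := by linarith
  have h2 : 0 < 2 - 2 * δ := by linarith
  set K : ℝ := 1 / (2 - 2 * δ) + 1 / (2 * δ)
  have hKpos : 0 < K := by positivity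
  refine ⟨K ^ ((1 : ℝ) / 2), by positivity, ?_⟩
  rintro η ⟨hη, -⟩
  set f : ℝ → ℝ := fun s => max 0 (1 - (1 - s) / η) with hf
  have hzero : ∀ s ≤ 1 - η, f s = 0 := fun s hs =>
    max_eq_left (sub_nonpos.2 ((one_le_div hη).2 (by linarith)))
  have hle_one : ∀ s ≤ 1, f s ≤ 1 := fun s hs =>
    max_le zero_le_one (sub_le_self _ (div_nonneg (by linarith) hη.le))
  have hnonneg : ∀ s, 0 ≤ f s := fun s => le_max_left _ _
  have hlip : ∀ t, ∀ s ≤ t, |f t - f s| ≤ (t - s) / η := by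
    intro t s hst
    have := abs_max_sub_max_le_abs (1 - (1 - t) / η) (1 - (1 - s) / η) 0
    rw [show 1 - (1 - t) / η - (1 - (1 - s) / η) = (t - s) / η by ring,
      abs_of_nonneg (div_nonneg (sub_nonneg.2 hst) hη.le)] at this
    simpa only [hf, max_comm (0 : ℝ)] using this
  have hinner : ∀ t ∈ Set.Icc (0 : ℝ) 1,
      ∫⁻ s in Set.Icc (0 : ℝ) t, ENNReal.ofReal (|f t - f s| ^ 2 / (t - s) ^ (1 + 2 * δ)) ≤
        (Set.Icc (1 - η) 1).indicator (fun _ => ENNReal.ofReal (η ^ (-(2 * δ)) * K)) t := by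
    intro t ht
    by_cases hcase : 1 - η ≤ t
    · rw [Set.indicator_of_mem (show t ∈ Set.Icc (1 - η) 1 from ⟨hcase, ht.2⟩)]
      refine lintegral_increment_le hδ0 hδ1 hη (fun s hs => ?_) (hlip t)
      have := hle_one t ht.2
      have := hle_one s (hs.trans ht.2)
      have := hnonneg t
      have := hnonneg s
      exact abs_le.2 ⟨by linarith, by linarith⟩
    · rw [setLIntegral_congr_fun (g := 0) measurableSet_Icc]
      · simp
      · intro s hs
        simp [hzero t (not_le.1 hcase).le, hzero s (hs.2.trans (not_le.1 hcase).le)]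
  have hsq : sobolevSlobodeckijSqR δ f ≤ ENNReal.ofReal (K * η ^ (1 - 2 * δ)) := by
    calc sobolevSlobodeckijSqR δ f
        ≤ ∫⁻ t in Set.Icc (0 : ℝ) 1, (Set.Icc (1 - η) 1).indicator
            (fun _ => ENNReal.ofReal (η ^ (-(2 * δ)) * K)) t :=
          setLIntegral_mono' measurableSet_Icc hinner
      _ ≤ ∫⁻ t, (Set.Icc (1 - η) 1).indicator
            (fun _ => ENNReal.ofReal (η ^ (-(2 * δ)) * K)) t := setLIntegral_le_lintegral _ _
      _ = ENNReal.ofReal (K * η ^ (1 - 2 * δ)) := by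
          rw [lintegral_indicator_const measurableSet_Icc, Real.volume_Icc, sub_sub_cancel,
            ← ENNReal.ofReal_mul (by positivity), show 1 - 2 * δ = -(2 * δ) + 1 by ring,
            Real.rpow_add hη, Real.rpow_one]
          congr 1
          ring
  calc sobolevSlobodeckijSqR δ f ^ ((1 : ℝ) / 2)
      ≤ ENNReal.ofReal (K * η ^ (1 - 2 * δ)) ^ ((1 : ℝ) / 2) :=
        ENNReal.rpow_le_rpow hsq (by norm_num)
    _ = ENNReal.ofReal (K ^ ((1 : ℝ) / 2) * η ^ (1 / 2 - δ)) := by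
        rw [ENNReal.ofReal_rpow_of_nonneg (by positivity) (by norm_num),
          Real.mul_rpow hKpos.le (by positivity), ← Real.rpow_mul hη.le]
        congr 3
        ring
end
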